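/- Integer values of a root are rigid on a facet: if σ is a facet, r ∈ R, and r(p) ∈ ℤ for some point p ∈ σ, then r is constant on σ, i.e. r(p') = r(p) for every p' ∈ σ. -/

import Mathlib

open Set

/-- The set of affine roots `(r, n)` with `r ∈ R`, `n : ℤ`, vanishing at the point `x`,
i.e. such that `r x + n = 0`.  This is the set `Y_x`. -/
def affineRootsVanishingAt {V : Type*} [NormedAddCommGroup V] [NormedSpace ℝ V]
    (R : Finset (V →ₗ[ℝ] ℝ)) (x : V) : Set ((V →ₗ[ℝ] ℝ) × ℤ) :=
  {α | α.1 ∈ R ∧ α.1 x + (α.2 : ℝ) = 0}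

/-- `H_n`: the set of points where exactly `n` affine roots vanish. -/
def Hset {V : Type*} [NormedAddCommGroup V] [NormedSpace ℝ V]
    (R : Finset (V →ₗ[ℝ] ℝ)) (n : ℕ) : Set V :=
  {x | (affineRootsVanishingAt R x).ncard = n}

/-- A facet is a connected component of some `H_n`. -/
def IsFacet {V : Type*} [NormedAddCommGroup V] [NormedSpace ℝ V]
    (R : Finset (V →ₗ[ℝ] ℝ)) (σ : Set V) : Prop :=
  ∃ (n : ℕ) (x : V), x ∈ Hset R n ∧ σ = connectedComponentIn (Hset R n) x

theorem finite_affineRootsVanishingAt {V : Type*} [NormedAddCommGroup V] [NormedSpace ℝ V]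
    (R : Finset (V →ₗ[ℝ] ℝ)) (x : V) : (affineRootsVanishingAt R x).Finite := by
  refine Set.Finite.of_finite_image (f := Prod.fst)
    (R.finite_toSet.subset ?_) ?_
  · rintro _ ⟨α, hα, rfl⟩
    exact hα.1
  · rintro ⟨r, k⟩ ⟨_, hk⟩ ⟨r', l⟩ ⟨_, hl⟩ h
    obtain rfl : r = r' := h
    have hkl : (k : ℝ) = l := by
      simp only at hk hl
      linarith
    rw [Int.cast_injective hkl]

theorem eventually_forall_int_eq_imp_eq (s : ℝ) :
    ∀ᶠ t : ℝ in nhds s, ∀ n : ℤ, t + n = 0 → s + n = 0 := by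
  have hc : IsClosed ((fun n : ℤ => (n : ℝ)) '' {n : ℤ | (n : ℝ) ≠ s}) :=
    Int.isClosedEmbedding_coe_real.isClosedMap _ (isClosed_discrete _)
  have hs : s ∉ (fun n : ℤ => (n : ℝ)) '' {n : ℤ | (n : ℝ) ≠ s} := by
    rintro ⟨n, hn, h⟩
    exact hn h
  filter_upwards [hc.isOpen_compl.mem_nhds hs] with t ht n hn
  by_contra hne
  refine ht ⟨-n, fun h => hne ?_, ?_⟩
  · push_cast at h
    linarith
  · push_cast
    linarith

/-- Near `y`, an affine root can only vanish if it already vanishes at `y`. -/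
theorem eventually_affineRootsVanishingAt_subset {V : Type*} [NormedAddCommGroup V]
    [NormedSpace ℝ V] [FiniteDimensional ℝ V] (R : Finset (V →ₗ[ℝ] ℝ)) (y : V) :
    ∀ᶠ x in nhds y, affineRootsVanishingAt R x ⊆ affineRootsVanishingAt R y := by
  have h : ∀ᶠ x in nhds y, ∀ r ∈ R, ∀ n : ℤ, r x + n = 0 → r y + n = 0 :=
    (Filter.eventually_all_finset R).2 fun r _ =>
      r.continuous_of_finiteDimensional.continuousAt.eventually
        (eventually_forall_int_eq_imp_eq (r y))
  filter_upwards [h] with x hx α hα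
  exact ⟨hα.1, hx α.1 hα.1 α.2 hα.2⟩

theorem eventually_affineRootsVanishingAt_eq {V : Type*} [NormedAddCommGroup V]
    [NormedSpace ℝ V] [FiniteDimensional ℝ V] (R : Finset (V →ₗ[ℝ] ℝ)) {n : ℕ} {y : V}
    (hy : y ∈ Hset R n) :
    ∀ᶠ x in nhdsWithin y (Hset R n), affineRootsVanishingAt R x = affineRootsVanishingAt R y := by
  filter_upwards [nhdsWithin_le_nhds (eventually_affineRootsVanishingAt_subset R y),
    self_mem_nhdsWithin] with x hx hxn
  exact Set.eq_of_subset_of_ncard_le hx (hy.trans hxn.symm).le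
    (finite_affineRootsVanishingAt R y)

theorem IsFacet.affineRootsVanishingAt_eq {V : Type*} [NormedAddCommGroup V]
    [NormedSpace ℝ V] [FiniteDimensional ℝ V] {R : Finset (V →ₗ[ℝ] ℝ)} {σ : Set V}
    (hσ : IsFacet R σ) {p q : V} (hp : p ∈ σ) (hq : q ∈ σ) :
    affineRootsVanishingAt R p = affineRootsVanishingAt R q := by
  obtain ⟨n, x, -, rfl⟩ := hσ
  let _ : TopologicalSpace (Set ((V →ₗ[ℝ] ℝ) × ℤ)) := ⊥
  have : DiscreteTopology (Set ((V →ₗ[ℝ] ℝ) × ℤ)) := ⟨rfl⟩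
  have hc : ContinuousOn (affineRootsVanishingAt R) (Hset R n) := fun y hy =>
    continuousWithinAt_const.congr_of_eventuallyEq
      (eventually_affineRootsVanishingAt_eq R hy) rfl
  exact isPreconnected_connectedComponentIn.constant
    (hc.mono (connectedComponentIn_subset _ _)) hp hq

theorem root_integer_value_rigid_on_facet {V : Type*} [NormedAddCommGroup V] [NormedSpace ℝ V] [FiniteDimensional ℝ V]
    (R : Finset (V →ₗ[ℝ] ℝ)) (hR : ∀ r ∈ R, r ≠ 0)
    (σ : Set V) (hσ : IsFacet R σ) (r : V →ₗ[ℝ] ℝ) (hr : r ∈ R)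
    (p : V) (hp : p ∈ σ) (m : ℤ) (hm : r p = m) :
    ∀ p' ∈ σ, r p' = r p := by
  intro p' hp'
  have h : (r, -m) ∈ affineRootsVanishingAt R p := ⟨hr, by simp [hm]⟩
  rw [hσ.affineRootsVanishingAt_eq hp hp'] at h
  have h0 : r p' + ((-m : ℤ) : ℝ) = 0 := h.2
  push_cast at h0
  linarith
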